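/- Let Δ be a simplicial complex on X = {x_1,…,x_n}, K a field, and α = (k_1,…,k_n) ∈ ℕ^n with all k_i ≥ 1. Then the facet ideal I(Δ) ⊆ K[x_1,…,x_n] has linear quotients if and only if the facet ideal I(Δ^α) ⊆ K[x_{ij} : 1 ≤ i ≤ n, 1 ≤ j ≤ k_i] has linear quotients. -/

import Mathlib

/-- An (abstract) simplicial complex: a collection of finite subsets of the vertex set
closed under taking subsets. -/
def IsComplex {V : Type*} (Δ : Set (Finset V)) : Prop :=
  ∀ ⦃F G : Finset V⦄, F ∈ Δ → G ⊆ F → G ∈ Δ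

/-- `F` is a facet (maximal face) of `Δ`. -/
def IsFacet {V : Type*} (Δ : Set (Finset V)) (F : Finset V) : Prop :=
  F ∈ Δ ∧ ∀ G ∈ Δ, F ⊆ G → F = G

/-- The faces of the expansion `⟨F⟩^α` of the simplex with facet `F`. -/
def simplexExpansion {V : Type*} [DecidableEq V] (F : Finset V) (α : V → ℕ) :
    Set (Finset ((v : V) × Fin (α v))) :=
  {G | G.image Sigma.fst ⊆ F ∧ Set.InjOn Sigma.fst (G : Set ((v : V) × Fin (α v)))}

/-- The expansion `Δ^α` of a simplicial complex `Δ` with respect to `α`. -/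
def expansion {V : Type*} [DecidableEq V] (Δ : Set (Finset V)) (α : V → ℕ) :
    Set (Finset ((v : V) × Fin (α v))) :=
  ⋃ F ∈ Δ, simplexExpansion F α

/-- The facet ideal `I(Δ) = (x^F : F ∈ 𝔉(Δ))` of a simplicial complex. -/
noncomputable def facetIdeal (K : Type*) [Field K] {V : Type*} (Δ : Set (Finset V)) :
    Ideal (MvPolynomial V K) :=
  Ideal.span ((fun F => ∏ v ∈ F, MvPolynomial.X v) '' {F | IsFacet Δ F})

/-- The facet ideal of `Δ` has linear quotients: there is an ordering `f_1, …, f_m` of its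
minimal monomial generators (the monomials `x^F` for the facets `F` of `Δ`) such that each
colon ideal `(f_1, …, f_{i-1}) : (f_i)` is generated by a subset of the variables. -/
def HasLinearQuotients (K : Type*) [Field K] {V : Type*} (Δ : Set (Finset V)) : Prop :=
  ∃ (m : ℕ) (f : Fin m → Finset V),
    Function.Injective f ∧ Set.range f = {F | IsFacet Δ F} ∧
    ∀ i : Fin m, 0 < i.val →
      ∃ T : Set V,
        (Ideal.span ((fun F => (∏ v ∈ F, MvPolynomial.X v : MvPolynomial V K)) ''
            {F | ∃ j : Fin m, j < i ∧ f j = F})).colon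
          (Ideal.span {(∏ v ∈ f i, MvPolynomial.X v : MvPolynomial V K)}) =
        Ideal.span (MvPolynomial.X '' T)

/-- `HasProjDimLE R n M` says that `M` admits a projective resolution of length at most `n`. -/
def HasProjDimLE (R : Type) [CommRing R] : ℕ → ∀ (M : Type) [AddCommGroup M] [Module R M], Prop
  | 0, M, _, _ => Module.Projective R M
  | n + 1, M, _, _ => ∃ (P : Type) (_ : AddCommGroup P) (_ : Module R P) (f : P →ₗ[R] M),
      Module.Projective R P ∧ Function.Surjective f ∧ HasProjDimLE R n (LinearMap.ker f)

/-- The projective dimension of a module: the length of a shortest projective resolution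
(`⊤` if there is no finite projective resolution). -/
noncomputable def projDim (R : Type) [CommRing R] (M : Type) [AddCommGroup M] [Module R M] :
    ℕ∞ :=
  sInf {n : ℕ∞ | ∃ k : ℕ, (k : ℕ∞) = n ∧ HasProjDimLE R k M}

section LinearQuotients

variable {V : Type*}

theorem IsFacet.eq_of_subset {Δ : Set (Finset V)} {F G : Finset V} (hF : IsFacet Δ F)
    (hG : IsFacet Δ G) (h : F ⊆ G) : F = G :=
  hF.2 G hG.1 h

/-- The exponent vector of the squarefree monomial `x^F`. -/
noncomputable def squarefreeExponent (F : Finset V) : V →₀ ℕ :=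
  ∑ v ∈ F, Finsupp.single v 1

theorem squarefreeExponent_apply [DecidableEq V] (F : Finset V) (x : V) :
    squarefreeExponent F x = if x ∈ F then 1 else 0 := by
  simp [squarefreeExponent, Finsupp.finsetSum_apply, Finsupp.single_apply]

theorem prod_X_eq_monomial (K : Type*) [Field K] (F : Finset V) :
    (∏ v ∈ F, MvPolynomial.X v : MvPolynomial V K) =
      MvPolynomial.monomial (squarefreeExponent F) 1 :=
  (MvPolynomial.monomial_sum_one F _).symm

theorem squarefreeExponent_le_add_iff {F H : Finset V} {m : V →₀ ℕ} :
    squarefreeExponent H ≤ m + squarefreeExponent F ↔ ∀ x ∈ H, x ∉ F → m x ≠ 0 := by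
  classical
  rw [Finsupp.le_def]
  refine forall_congr' fun x => ?_
  simp only [Finsupp.add_apply, squarefreeExponent_apply]
  split_ifs <;> simp_all
  omega

theorem mem_colon_squarefree_iff (K : Type*) [Field K] (S : Set (Finset V)) (F : Finset V)
    (p : MvPolynomial V K) :
    p ∈ (Ideal.span ((fun F => (∏ v ∈ F, MvPolynomial.X v : MvPolynomial V K)) '' S)).colon
        (Ideal.span {(∏ v ∈ F, MvPolynomial.X v : MvPolynomial V K)}) ↔
      ∀ m ∈ p.support, ∃ H ∈ S, ∀ x ∈ H, x ∉ F → m x ≠ 0 := by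
  have himage : (fun F => (∏ v ∈ F, MvPolynomial.X v : MvPolynomial V K)) '' S =
      (fun s => MvPolynomial.monomial s (1 : K)) '' (squarefreeExponent '' S) := by
    simp only [Set.image_image, prod_X_eq_monomial]
  have hsupport : (p * MvPolynomial.monomial (squarefreeExponent F) (1 : K)).support =
      p.support.map (addRightEmbedding (squarefreeExponent F)) :=
    AddMonoidAlgebra.support_coeff_mul_single p _ (by simp) _
  rw [Ideal.mem_colon_span_singleton, himage, prod_X_eq_monomial,
    MvPolynomial.mem_ideal_span_monomial_image, hsupport]
  simp [squarefreeExponent_le_add_iff]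

/-- The colon ideal of squarefree monomials is generated by variables exactly when every
`x^(G \ F)` is divisible by a variable of the form `x^(H \ F)`. -/
theorem exists_colon_eq_span_X_iff (K : Type*) [Field K] (S : Set (Finset V)) (F : Finset V)
    (hS : ∀ H ∈ S, ¬ H ⊆ F) :
    (∃ T : Set V,
        (Ideal.span ((fun F => (∏ v ∈ F, MvPolynomial.X v : MvPolynomial V K)) '' S)).colon
          (Ideal.span {(∏ v ∈ F, MvPolynomial.X v : MvPolynomial V K)}) =
        Ideal.span (MvPolynomial.X '' T)) ↔
      ∀ G ∈ S, ∃ H ∈ S, ∃ x ∈ G, x ∉ F ∧ x ∈ H ∧ ∀ y ∈ H, y ∉ F → y = x := by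
  classical
  constructor
  · rintro ⟨T, hT⟩ G hG
    have hmem : MvPolynomial.monomial (squarefreeExponent (G \ F)) (1 : K) ∈
        Ideal.span (MvPolynomial.X '' T) := by
      rw [← hT, mem_colon_squarefree_iff]
      intro m hm
      rw [MvPolynomial.support_monomial, if_neg one_ne_zero, Finset.mem_singleton] at hm
      subst hm
      exact ⟨G, hG, fun x hx hxF => by simp [squarefreeExponent_apply, hx, hxF]⟩
    obtain ⟨t, ht, htm⟩ := MvPolynomial.mem_ideal_span_X_image.1 hmem
      (squarefreeExponent (G \ F)) (by simp)
    obtain ⟨htG, htF⟩ : t ∈ G ∧ t ∉ F := by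
      simpa [squarefreeExponent_apply] using htm
    have hX : (MvPolynomial.X t : MvPolynomial V K) ∈
        Ideal.span (MvPolynomial.X '' T) := Ideal.subset_span ⟨t, ht, rfl⟩
    rw [← hT, mem_colon_squarefree_iff] at hX
    obtain ⟨H, hH, hHt⟩ := hX (Finsupp.single t 1) (by simp [MvPolynomial.support_X])
    have huniq : ∀ y ∈ H, y ∉ F → y = t := fun y hy hyF => by
      by_contra hne
      exact hHt y hy hyF (Finsupp.single_eq_of_ne hne)
    obtain ⟨y, hy, hyF⟩ := Finset.not_subset.1 (hS H hH)
    exact ⟨H, hH, t, htG, htF, huniq y hy hyF ▸ hy, huniq⟩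
  · intro h
    refine ⟨{x | ∃ H ∈ S, ∀ y ∈ H, y ∉ F → y = x}, ?_⟩
    ext p
    rw [mem_colon_squarefree_iff, MvPolynomial.mem_ideal_span_X_image]
    refine forall₂_congr fun m _ => ⟨?_, ?_⟩
    · rintro ⟨G, hG, hGm⟩
      obtain ⟨H, hH, x, hxG, hxF, -, hHx⟩ := h G hG
      exact ⟨x, ⟨H, hH, hHx⟩, hGm x hxG hxF⟩
    · rintro ⟨x, ⟨H, hH, hHx⟩, hx⟩
      exact ⟨H, hH, fun y hy hyF => hHx y hy hyF ▸ hx⟩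

/-- `r` ranks the facets of `Δ` in such a way that any refinement of the rank to a linear order
is a linear quotient order. -/
def IsLinearQuotientRank {β : Type*} [LinearOrder β] (Δ : Set (Finset V))
    (r : Finset V → β) : Prop :=
  ∀ F G, IsFacet Δ F → IsFacet Δ G → G ≠ F → r G ≤ r F →
    ∃ H, IsFacet Δ H ∧ r H < r F ∧ ∃ x ∈ G, x ∉ F ∧ x ∈ H ∧ ∀ y ∈ H, y ∉ F → y = x

theorem IsLinearQuotientRank.hasLinearQuotients [Finite V] (K : Type*) [Field K] {β : Type*}
    [LinearOrder β] {Δ : Set (Finset V)} {r : Finset V → β} (hr : IsLinearQuotientRank Δ r) :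
    HasLinearQuotients K Δ := by
  obtain ⟨m, ⟨e⟩⟩ := Finite.exists_equiv_fin {F | IsFacet Δ F}
  let g : Fin m → Finset V := fun i => (e.symm i : Finset V)
  let σ := Tuple.sort (r ∘ g)
  have hmono : Monotone (r ∘ (g ∘ σ)) := Tuple.monotone_sort (r ∘ g)
  have hinj : Function.Injective (g ∘ σ) :=
    (Subtype.val_injective.comp e.symm.injective).comp σ.injective
  have hrange : Set.range (g ∘ σ) = {F | IsFacet Δ F} := by
    rw [σ.surjective.range_comp]
    exact (e.symm.surjective.range_comp _).trans Subtype.range_val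
  have hfacet : ∀ i, IsFacet Δ ((g ∘ σ) i) := fun i => hrange.subset ⟨i, rfl⟩
  refine ⟨m, g ∘ σ, hinj, hrange, fun i _ => ?_⟩
  rw [exists_colon_eq_span_X_iff]
  · rintro _ ⟨j, hj, rfl⟩
    obtain ⟨H, hH, hlt, hx⟩ :=
      hr _ _ (hfacet i) (hfacet j) (hinj.ne hj.ne) (hmono hj.le)
    obtain ⟨k, rfl⟩ := hrange.superset hH
    exact ⟨_, ⟨k, hmono.reflect_lt hlt, rfl⟩, hx⟩
  · rintro _ ⟨j, hj, rfl⟩ hsub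
    exact hj.ne (hinj ((hfacet j).eq_of_subset (hfacet i) hsub))

theorem HasLinearQuotients.exists_rank {K : Type*} [Field K] {Δ : Set (Finset V)}
    (h : HasLinearQuotients K Δ) : ∃ r : Finset V → ℕ, IsLinearQuotientRank Δ r := by
  obtain ⟨m, f, hinj, hrange, hf⟩ := h
  have hfacet : ∀ i, IsFacet Δ (f i) := fun i => hrange.subset ⟨i, rfl⟩
  have hr : ∀ i, Function.extend f Fin.val 0 (f i) = i.val := hinj.extend_apply _ _
  refine ⟨Function.extend f Fin.val 0, fun F G hF hG hne hle => ?_⟩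
  obtain ⟨i, rfl⟩ := hrange.superset hF
  obtain ⟨j, rfl⟩ := hrange.superset hG
  rw [hr, hr] at hle
  have hji : j < i := lt_of_le_of_ne hle fun h => hne (h ▸ rfl)
  have hlin := hf i (by have : j.val < i.val := hji; omega)
  rw [exists_colon_eq_span_X_iff] at hlin
  · obtain ⟨_, ⟨k, hk, rfl⟩, hx⟩ := hlin _ ⟨j, hji, rfl⟩
    exact ⟨f k, hfacet k, by rw [hr, hr]; exact hk, hx⟩
  · rintro _ ⟨k, hk, rfl⟩ hsub
    exact hk.ne (hinj ((hfacet k).eq_of_subset (hfacet i) hsub))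

end LinearQuotients

section Expansion

variable {V : Type*} [DecidableEq V] {α : V → ℕ}

theorem mem_expansion_iff {Δ : Set (Finset V)} (hΔ : IsComplex Δ)
    {G : Finset ((v : V) × Fin (α v))} :
    G ∈ expansion Δ α ↔
      G.image Sigma.fst ∈ Δ ∧ Set.InjOn Sigma.fst (G : Set ((v : V) × Fin (α v))) := by
  simp only [expansion, simplexExpansion, Set.mem_iUnion, Set.mem_ofPred_eq, exists_prop]
  exact ⟨fun ⟨F, hF, hG, hinj⟩ => ⟨hΔ hF hG, hinj⟩,
    fun ⟨hG, hinj⟩ => ⟨_, hG, subset_rfl, hinj⟩⟩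

theorem isFacet_expansion_iff {Δ : Set (Finset V)} (hΔ : IsComplex Δ) (hα : ∀ v, 1 ≤ α v)
    {G : Finset ((v : V) × Fin (α v))} :
    IsFacet (expansion Δ α) G ↔
      IsFacet Δ (G.image Sigma.fst) ∧
        Set.InjOn Sigma.fst (G : Set ((v : V) × Fin (α v))) := by
  constructor
  · rintro ⟨hG, hmax⟩
    obtain ⟨hGΔ, hinj⟩ := (mem_expansion_iff hΔ).1 hG
    refine ⟨⟨hGΔ, fun F hF hsub => hsub.antisymm fun v hv => ?_⟩, hinj⟩
    by_contra hvG
    let p : (v : V) × Fin (α v) := ⟨v, ⟨0, hα v⟩⟩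
    have hface : insert p G ∈ expansion Δ α := by
      rw [mem_expansion_iff hΔ, Finset.image_insert, Finset.coe_insert]
      refine ⟨hΔ hF (Finset.insert_subset hv hsub), ?_⟩
      rw [Set.injOn_insert]
      · exact ⟨hinj, by simpa [p] using hvG⟩
      · exact fun hp => hvG (Finset.mem_image_of_mem Sigma.fst hp)
    have hp : p ∈ G := by
      rw [hmax _ hface (Finset.subset_insert p G)]
      exact Finset.mem_insert_self p G
    exact hvG (Finset.mem_image_of_mem Sigma.fst hp)
  · rintro ⟨⟨hGΔ, hmax⟩, hinj⟩
    refine ⟨(mem_expansion_iff hΔ).2 ⟨hGΔ, hinj⟩, fun G' hG' hsub => hsub.antisymm ?_⟩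
    obtain ⟨hG'Δ, hinj'⟩ := (mem_expansion_iff hΔ).1 hG'
    intro p hp
    have hp' : p.1 ∈ G.image Sigma.fst := by
      rw [hmax _ hG'Δ (Finset.image_subset_image hsub)]
      exact Finset.mem_image_of_mem Sigma.fst hp
    obtain ⟨q, hq, hqp⟩ := Finset.mem_image.1 hp'
    exact hinj' (hsub hq) hp hqp ▸ hq

/-- The copy of `F` in the expansion consisting of the first copies of its vertices. -/
def baseLift (hα : ∀ v, 1 ≤ α v) (F : Finset V) : Finset ((v : V) × Fin (α v)) :=
  F.image fun v => ⟨v, ⟨0, hα v⟩⟩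

theorem mem_baseLift_iff (hα : ∀ v, 1 ≤ α v) {F : Finset V} {p : (v : V) × Fin (α v)} :
    p ∈ baseLift hα F ↔ p.1 ∈ F ∧ p.2.val = 0 := by
  obtain ⟨v, c, hc⟩ := p
  constructor
  · intro h
    obtain ⟨w, hw, he⟩ := Finset.mem_image.1 h
    cases he
    exact ⟨hw, rfl⟩
  · rintro ⟨hv, rfl⟩
    exact Finset.mem_image_of_mem _ hv

theorem image_fst_baseLift (hα : ∀ v, 1 ≤ α v) (F : Finset V) :
    (baseLift hα F).image Sigma.fst = F := by
  simp [baseLift, Finset.image_image, Function.comp_def]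

theorem isFacet_baseLift_iff {Δ : Set (Finset V)} (hΔ : IsComplex Δ) (hα : ∀ v, 1 ≤ α v)
    {F : Finset V} : IsFacet (expansion Δ α) (baseLift hα F) ↔ IsFacet Δ F := by
  rw [isFacet_expansion_iff hΔ hα, image_fst_baseLift, and_iff_left_iff_imp]
  rintro - ⟨v, a, ha⟩ hp ⟨w, b, hb⟩ hq (rfl : v = w)
  obtain rfl : a = 0 := ((mem_baseLift_iff hα).1 hp).2
  obtain rfl : b = 0 := ((mem_baseLift_iff hα).1 hq).2
  rfl

theorem IsLinearQuotientRank.comp_baseLift {Δ : Set (Finset V)} (hΔ : IsComplex Δ)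
    (hα : ∀ v, 1 ≤ α v) {β : Type*} [LinearOrder β]
    {r : Finset ((v : V) × Fin (α v)) → β} (hr : IsLinearQuotientRank (expansion Δ α) r) :
    IsLinearQuotientRank Δ (r ∘ baseLift hα) := by
  intro F G hF hG hne hle
  have hne' : baseLift hα G ≠ baseLift hα F := fun h => hne <| by
    rw [← image_fst_baseLift hα G, h, image_fst_baseLift]
  obtain ⟨H, hH, hlt, x, hxG, hxF, hxH, huniq⟩ := hr _ _ ((isFacet_baseLift_iff hΔ hα).2 hF)
    ((isFacet_baseLift_iff hΔ hα).2 hG) hne' hle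
  obtain ⟨hxG₁, hx₀⟩ := (mem_baseLift_iff hα).1 hxG
  have hzero : ∀ p ∈ H, p.2.val = 0 := fun p hp => by
    by_cases hpF : p ∈ baseLift hα F
    · exact ((mem_baseLift_iff hα).1 hpF).2
    · exact huniq p hp hpF ▸ hx₀
  have hHlift : baseLift hα (H.image Sigma.fst) = H := by
    ext ⟨v, c, hc⟩
    rw [mem_baseLift_iff, Finset.mem_image]
    constructor
    · rintro ⟨⟨⟨w, b, hb⟩, hq, rfl : w = v⟩, rfl : c = 0⟩
      obtain rfl : b = 0 := hzero _ hq
      exact hq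
    · exact fun hp => ⟨⟨_, hp, rfl⟩, hzero _ hp⟩
  refine ⟨H.image Sigma.fst, (isFacet_baseLift_iff hΔ hα).1 (by rwa [hHlift]),
    by simpa only [Function.comp_apply, hHlift] using hlt, x.1, hxG₁,
    fun h => hxF ((mem_baseLift_iff hα).2 ⟨h, hx₀⟩), Finset.mem_image_of_mem _ hxH, ?_⟩
  intro v hv hvF
  obtain ⟨p, hp, rfl⟩ := Finset.mem_image.1 hv
  rw [huniq p hp fun h => hvF ((mem_baseLift_iff hα).1 h).1]

/-- Ranking by the rank of the image in `Δ`, then by the sum of the copy indices. -/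
def expansionRank (r : Finset V → ℕ) (G : Finset ((v : V) × Fin (α v))) : ℕ ×ₗ ℕ :=
  toLex (r (G.image Sigma.fst), ∑ p ∈ G, p.2.val)

theorem exists_fst_eq_and_lt_of_sum_le {F G : Finset ((v : V) × Fin (α v))}
    (hF : Set.InjOn Sigma.fst (F : Set ((v : V) × Fin (α v))))
    (hG : Set.InjOn Sigma.fst (G : Set ((v : V) × Fin (α v))))
    (himage : G.image Sigma.fst = F.image Sigma.fst) (hne : G ≠ F)
    (hle : ∑ p ∈ G, p.2.val ≤ ∑ p ∈ F, p.2.val) :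
    ∃ p ∈ F, ∃ q ∈ G, q.1 = p.1 ∧ q.2.val < p.2.val := by
  by_contra! hcon
  have hex : ∀ p ∈ F, ∃ q ∈ G, q.1 = p.1 := fun p hp => by
    simpa using himage.superset (Finset.mem_image_of_mem Sigma.fst hp)
  choose! φ hφG hφ using hex
  have hφinj : Set.InjOn φ (F : Set ((v : V) × Fin (α v))) := fun p hp q hq h =>
    hF hp hq (by rw [← hφ p hp, ← hφ q hq, h])
  have hφimage : F.image φ = G := by
    ext q
    rw [Finset.mem_image]
    constructor
    · rintro ⟨p, hp, rfl⟩
      exact hφG p hp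
    · intro hq
      obtain ⟨p, hp, hpq⟩ :=
        Finset.mem_image.1 (himage.subset (Finset.mem_image_of_mem Sigma.fst hq))
      exact ⟨p, hp, hG (hφG p hp) hq ((hφ p hp).trans hpq)⟩
  have hsum : ∑ p ∈ G, p.2.val = ∑ p ∈ F, (φ p).2.val := by
    rw [← hφimage, Finset.sum_image hφinj]
  have hpt : ∀ p ∈ F, p.2.val ≤ (φ p).2.val := fun p hp => hcon p hp _ (hφG p hp) (hφ p hp)
  have heq := (Finset.sum_eq_sum_iff_of_le hpt).1
    (le_antisymm (Finset.sum_le_sum hpt) (hsum ▸ hle))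
  have hid : ∀ p ∈ F, φ p = p := fun p hp => by
    have h₁ := hφ p hp
    have h₂ := heq p hp
    generalize φ p = q at h₁ h₂
    obtain ⟨v, a⟩ := p
    obtain ⟨w, b⟩ := q
    obtain rfl : w = v := h₁
    obtain rfl : a = b := Fin.ext h₂
    rfl
  exact hne <| by rw [← hφimage, Finset.image_congr hid, Finset.image_id']

theorem IsLinearQuotientRank.expansionRank {Δ : Set (Finset V)} (hΔ : IsComplex Δ)
    (hα : ∀ v, 1 ≤ α v) {r : Finset V → ℕ} (hr : IsLinearQuotientRank Δ r) :
    IsLinearQuotientRank (expansion Δ α) (expansionRank r) := by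
  intro F G hF hG hne hle
  obtain ⟨hFΔ, hFinj⟩ := (isFacet_expansion_iff hΔ hα).1 hF
  obtain ⟨hGΔ, hGinj⟩ := (isFacet_expansion_iff hΔ hα).1 hG
  have hle' := Prod.Lex.toLex_le_toLex.1 hle
  by_cases himage : G.image Sigma.fst = F.image Sigma.fst
  · have hsum : ∑ p ∈ G, p.2.val ≤ ∑ p ∈ F, p.2.val := by
      rcases hle' with h | ⟨-, h⟩
      · exact absurd h (by simp only [himage, lt_irrefl, not_false_eq_true])
      · exact h
    obtain ⟨p, hp, q, hq, hqp, hlt⟩ :=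
      exists_fst_eq_and_lt_of_sum_le hFinj hGinj himage hne hsum
    have hqF : q ∉ F := fun h => by
      rw [hFinj h hp hqp] at hlt
      exact lt_irrefl _ hlt
    have hqE : q ∉ F.erase p := fun h => hqF (Finset.mem_of_mem_erase h)
    have hHimage : (insert q (F.erase p)).image Sigma.fst = F.image Sigma.fst := by
      conv_rhs => rw [← Finset.insert_erase hp]
      rw [Finset.image_insert, Finset.image_insert, hqp]
    have hHinj : Set.InjOn Sigma.fst
        (↑(insert q (F.erase p)) : Set ((v : V) × Fin (α v))) := by
      rw [Finset.coe_insert, Set.injOn_insert hqE]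
      refine ⟨hFinj.mono (Finset.coe_subset.2 (Finset.erase_subset p F)), ?_⟩
      rintro ⟨s, hs, hsq⟩
      exact (Finset.mem_erase.1 hs).1
        (hFinj (Finset.mem_of_mem_erase hs) hp (hsq.trans hqp))
    refine ⟨insert q (F.erase p), (isFacet_expansion_iff hΔ hα).2 ⟨hHimage ▸ hFΔ, hHinj⟩,
      Prod.Lex.toLex_lt_toLex.2 (Or.inr ⟨by rw [hHimage], ?_⟩), q, hq, hqF,
      Finset.mem_insert_self _ _, fun y hy hyF => ?_⟩
    · simp only
      rw [Finset.sum_insert hqE, ← Finset.add_sum_erase F _ hp]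
      exact Nat.add_lt_add_right hlt _
    · exact (Finset.mem_insert.1 hy).resolve_right fun h => hyF (Finset.mem_of_mem_erase h)
  · have hrle : r (G.image Sigma.fst) ≤ r (F.image Sigma.fst) := by
      rcases hle' with h | ⟨h, -⟩
      · exact h.le
      · exact h.le
    obtain ⟨H, hH, hlt, x, hxG, hxF, hxH, huniq⟩ := hr _ _ hFΔ hGΔ himage hrle
    obtain ⟨q, hq, rfl⟩ := Finset.mem_image.1 hxG
    have hqF : q ∉ F := fun h => hxF (Finset.mem_image_of_mem _ h)
    have hLimage : (insert q (F.filter fun p => p.1 ∈ H)).image Sigma.fst = H := by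
      ext v
      simp only [Finset.image_insert, Finset.mem_insert, Finset.mem_image, Finset.mem_filter]
      constructor
      · rintro (rfl | ⟨p, ⟨-, hp⟩, rfl⟩)
        · exact hxH
        · exact hp
      · intro hv
        by_cases hvF : v ∈ F.image Sigma.fst
        · obtain ⟨p, hp, rfl⟩ := Finset.mem_image.1 hvF
          exact Or.inr ⟨p, ⟨hp, hv⟩, rfl⟩
        · exact Or.inl (huniq v hv hvF)
    refine ⟨insert q (F.filter fun p => p.1 ∈ H),
      (isFacet_expansion_iff hΔ hα).2 ⟨hLimage.symm ▸ hH, ?_⟩,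
      Prod.Lex.toLex_lt_toLex.2 (Or.inl (by simpa only [hLimage] using hlt)), q, hq, hqF,
      Finset.mem_insert_self _ _, fun y hy hyF => ?_⟩
    · rw [Finset.coe_insert, Set.injOn_insert fun h => hqF (Finset.mem_filter.1 h).1]
      refine ⟨hFinj.mono (Finset.coe_subset.2 (Finset.filter_subset _ F)), ?_⟩
      rintro ⟨s, hs, hsq⟩
      exact hxF (Finset.mem_image.2 ⟨s, (Finset.mem_filter.1 hs).1, hsq⟩)
    · exact (Finset.mem_insert.1 hy).resolve_right fun h => hyF (Finset.mem_filter.1 h).1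

end Expansion

/-- `I(Δ)` has linear quotients iff `I(Δ^α)` has linear quotients. -/
theorem hasLinearQuotients_expansion_iff (n : ℕ) (K : Type*) [Field K]
    (Δ : Set (Finset (Fin n))) (hΔ : IsComplex Δ)
    (α : Fin n → ℕ) (hα : ∀ i, 1 ≤ α i) :
    HasLinearQuotients K Δ ↔ HasLinearQuotients K (expansion Δ α) := by
  constructor
  · intro h
    obtain ⟨r, hr⟩ := h.exists_rank
    exact (hr.expansionRank hΔ hα).hasLinearQuotients K
  · intro h
    obtain ⟨r, hr⟩ := h.exists_rank
    exact (hr.comp_baseLift hΔ hα).hasLinearQuotients K
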